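/- arXiv:0912.5276 — 3 statements merged into one kernel-verified Lean document; each statement's English description precedes it below -/
import Mathlib

section
/- Let n ≥ 1 be an integer, let A ⊆ S^{n−1} be a measurable subset of the unit sphere, and let t > 0. Define the t-boundary A_t := {x ∈ S^{n−1} : d(x, A) ≤ t}, where d(x, A) is the infimum over y ∈ A of the Euclidean distance ‖x − y‖. Then ν(A) · ν(S^{n−1} \ A_t) ≤ 4 e^{−t²n/4}. -/
open MeasureTheory
open scoped Pointwise

theorem volume_add_volume_le_of_isCompact {K L C : Set ℝ} (hK : IsCompact K) (hL : IsCompact L)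
    (hK₀ : K.Nonempty) (hL₀ : L.Nonempty) (h : ∀ a ∈ K, ∀ b ∈ L, (a + b) / 2 ∈ C) :
    volume K + volume L ≤ 2 * volume C := by
  obtain ⟨k, hkK, hk⟩ := hK.exists_isGreatest hK₀
  obtain ⟨l, hlL, hl⟩ := hL.exists_isLeast hL₀
  have hdisj : AEDisjoint volume ((fun x => x + l) '' K) ((fun x => k + x) '' L) := by
    refine measure_mono_null (t := {k + l}) ?_ (by simp)
    rintro _ ⟨⟨a, ha, rfl⟩, b, hb, hab⟩
    have h₁ := hk ha
    have h₂ := hl hb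
    simp only at hab
    simp only [Set.mem_singleton_iff]
    linarith
  have hmeas : MeasurableSet ((fun x => k + x) '' L) :=
    (hL.image (by fun_prop)).measurableSet
  calc volume K + volume L
      = volume ((fun x => x + l) '' K ∪ (fun x => k + x) '' L) := by
        rw [measure_union₀ hmeas.nullMeasurableSet hdisj]
        simp
    _ ≤ volume ((2 : ℝ) • C) := by
        refine measure_mono ?_
        rintro _ (⟨a, ha, rfl⟩ | ⟨b, hb, rfl⟩)
        · exact ⟨_, h a ha l hlL, by simp; ring⟩
        · exact ⟨_, h k hkK b hb, by simp; ring⟩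
    _ = 2 * volume C := by simp [Measure.addHaar_smul]

/-- The one-dimensional Brunn-Minkowski inequality, for midpoints. -/
theorem volume_add_volume_le {A B C : Set ℝ} (hA : MeasurableSet A) (hB : MeasurableSet B)
    (hA₀ : A.Nonempty) (hB₀ : B.Nonempty) (h : ∀ a ∈ A, ∀ b ∈ B, (a + b) / 2 ∈ C) :
    volume A + volume B ≤ 2 * volume C := by
  obtain ⟨a, ha⟩ := hA₀
  obtain ⟨b, hb⟩ := hB₀
  rw [hA.measure_eq_iSup_isCompact, hB.measure_eq_iSup_isCompact]
  simp_rw [iSup_and']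
  refine ENNReal.biSup_add_biSup_le' ⟨∅, by simp⟩ ⟨∅, by simp⟩ fun K hK L hL => ?_
  calc volume K + volume L ≤ volume (insert a K) + volume (insert b L) := by gcongr <;> simp
    _ ≤ 2 * volume C :=
      volume_add_volume_le_of_isCompact (hK.2.insert a) (hL.2.insert b) (by simp) (by simp)
        fun x hx y hy => h x (Set.insert_subset ha hK.1 hx) y (Set.insert_subset hb hL.1 hy)

theorem ENNReal.four_mul_le_add_sq (a b : ENNReal) : 4 * (a * b) ≤ (a + b) ^ 2 := by
  wlog hab : a ≤ b generalizing a b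
  · rw [mul_comm a, add_comm]; exact this b a (le_of_not_ge hab)
  obtain ⟨c, rfl⟩ := exists_add_of_le hab
  calc 4 * (a * (a + c)) ≤ 4 * (a * (a + c)) + c ^ 2 := le_self_add
    _ = _ := by ring

theorem lintegral_add_lintegral_le_of_iSup_eq_one {f g h : ℝ → ENNReal} (hf : Measurable f)
    (hg : Measurable g) (hh : Measurable h) (hf₁ : ⨆ x, f x = 1) (hg₁ : ⨆ x, g x = 1)
    (hfgh : ∀ x y, f x * g y ≤ h ((x + y) / 2) ^ 2) :
    (∫⁻ x, f x) + ∫⁻ x, g x ≤ 2 * ∫⁻ x, h x := by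
  have layer {u : ℝ → ENNReal} (hu : Measurable u) :
      ∫⁻ s in Set.Ioo 0 1, volume {x | ENNReal.ofReal s < u x} ≤ ∫⁻ x, u x := by
    calc ∫⁻ s in Set.Ioo 0 1, volume {x | ENNReal.ofReal s < u x}
        ≤ ∫⁻ s in Set.Ioi 0, volume {x | s < (min (u x) 1).toReal} := by
          refine (setLIntegral_mono' measurableSet_Ioo fun s hs => ?_).trans
            (lintegral_mono_set Set.Ioo_subset_Ioi_self)
          refine measure_mono fun x hx => ?_
          rw [Set.mem_ofPred_eq, ← ENNReal.ofReal_lt_iff_lt_toReal hs.1.le (by simp)]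
          exact lt_min hx (by simpa using hs.2)
      _ = ∫⁻ x, ENNReal.ofReal (min (u x) 1).toReal :=
          (lintegral_eq_lintegral_meas_lt _ (by filter_upwards; simp)
            (hu.min measurable_const).ennreal_toReal.aemeasurable).symm
      _ ≤ ∫⁻ x, u x := lintegral_mono fun x => ENNReal.ofReal_toReal_le.trans (min_le_left _ _)
  have layer_eq {u : ℝ → ENNReal} (hu : Measurable u) (hu₁ : ∀ x, u x ≤ 1) :
      ∫⁻ x, u x = ∫⁻ s in Set.Ioo 0 1, volume {x | ENNReal.ofReal s < u x} := by
    refine le_antisymm ?_ (layer hu)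
    calc ∫⁻ x, u x = ∫⁻ x, ENNReal.ofReal (u x).toReal :=
          lintegral_congr fun x =>
            (ENNReal.ofReal_toReal ((hu₁ x).trans_lt ENNReal.one_lt_top).ne).symm
      _ = ∫⁻ s in Set.Ioi 0, volume {x | s < (u x).toReal} :=
          lintegral_eq_lintegral_meas_lt _ (by filter_upwards; simp)
            hu.ennreal_toReal.aemeasurable
      _ ≤ ∫⁻ s in Set.Ioo 0 1, volume {x | ENNReal.ofReal s < u x} := by
          rw [← lintegral_indicator measurableSet_Ioi, ← lintegral_indicator measurableSet_Ioo]
          refine lintegral_mono_ae ?_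
          filter_upwards [compl_mem_ae_iff.2 (Real.volume_singleton (a := 1))] with s hs
          by_cases h0 : 0 < s
          · by_cases h1 : s < 1
            · rw [Set.indicator_of_mem (by exact h0), Set.indicator_of_mem (by exact ⟨h0, h1⟩)]
              refine measure_mono fun x hx => ?_
              exact ENNReal.ofReal_lt_iff_lt_toReal h0.le
                ((hu₁ x).trans_lt ENNReal.one_lt_top).ne |>.2 hx
            · rw [Set.indicator_of_mem (by exact h0)]
              have : {x | s < (u x).toReal} = ∅ := by
                ext x
                have := ENNReal.toReal_mono ENNReal.one_ne_top (hu₁ x)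
                simp at this ⊢
                linarith
              simp [this]
          · rw [Set.indicator_of_notMem (by exact h0)]
            exact zero_le
  have nonempty {u : ℝ → ENNReal} (hu : ⨆ x, u x = 1) {s : ℝ} (hs : s < 1) :
      {x | ENNReal.ofReal s < u x}.Nonempty := by
    exact lt_iSup_iff.1 (hu ▸ (by simpa using hs) : ENNReal.ofReal s < ⨆ x, u x)
  have hm {u : ℝ → ENNReal} : Measurable fun s : ℝ => volume {x | ENNReal.ofReal s < u x} :=
    Antitone.measurable fun s s' hs => measure_mono fun x hx =>
      (ENNReal.ofReal_le_ofReal hs).trans_lt hx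
  rw [layer_eq hf fun x => hf₁ ▸ le_iSup f x, layer_eq hg fun x => hg₁ ▸ le_iSup g x,
    ← lintegral_add_left hm]
  refine le_trans ?_ (mul_le_mul_right (layer hh) 2)
  rw [← lintegral_const_mul _ hm]
  refine setLIntegral_mono' measurableSet_Ioo fun s hs => ?_
  refine volume_add_volume_le (measurableSet_lt measurable_const hf)
    (measurableSet_lt measurable_const hg) (nonempty hf₁ hs.2) (nonempty hg₁ hs.2) ?_
  intro x hx y hy
  change ENNReal.ofReal s < h ((x + y) / 2)
  refine lt_of_not_ge fun hle => (pow_le_pow_left₀ zero_le hle 2).not_gt ?_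
  calc ENNReal.ofReal s ^ 2 = ENNReal.ofReal s * ENNReal.ofReal s := sq _
    _ < f x * g y := ENNReal.mul_lt_mul hx hy
    _ ≤ _ := hfgh x y

/-- The one-dimensional Prékopa-Leindler inequality for bounded functions, at midpoints. -/
theorem lintegral_mul_lintegral_le_sq_of_bounded {f g h : ℝ → ENNReal} (hf : Measurable f)
    (hg : Measurable g) (hh : Measurable h) (hf_top : ⨆ x, f x ≠ ⊤) (hg_top : ⨆ x, g x ≠ ⊤)
    (hfgh : ∀ x y, f x * g y ≤ h ((x + y) / 2) ^ 2) :
    (∫⁻ x, f x) * ∫⁻ x, g x ≤ (∫⁻ x, h x) ^ 2 := by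
  set M := ⨆ x, f x with hM
  set N := ⨆ x, g x with hN
  by_cases hM₀ : M = 0
  · have : ∀ x, f x = 0 := by simpa [hM] using hM₀
    simp [this]
  by_cases hN₀ : N = 0
  · have : ∀ x, g x = 0 := by simpa [hN] using hN₀
    simp [this]
  obtain ⟨r, hr⟩ : ∃ r : ENNReal, r ^ 2 = M * N :=
    ⟨(M * N) ^ (2⁻¹ : ℝ), by rw [← ENNReal.rpow_natCast, ← ENNReal.rpow_mul]; simp⟩
  have key := lintegral_add_lintegral_le_of_iSup_eq_one (f := fun x => M⁻¹ * f x)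
    (g := fun x => N⁻¹ * g x) (h := fun x => r⁻¹ * h x) (hf.const_mul _) (hg.const_mul _)
    (hh.const_mul _) (by rw [← ENNReal.mul_iSup, ENNReal.inv_mul_cancel hM₀ hf_top])
    (by rw [← ENNReal.mul_iSup, ENNReal.inv_mul_cancel hN₀ hg_top]) fun x y => by
      calc M⁻¹ * f x * (N⁻¹ * g y) = (M * N)⁻¹ * (f x * g y) := by
            rw [ENNReal.mul_inv (.inl hM₀) (.inl hf_top)]; ring
        _ ≤ (M * N)⁻¹ * h ((x + y) / 2) ^ 2 := by gcongr; exact hfgh x y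
        _ = _ := by rw [← hr, mul_pow, ENNReal.inv_pow]
  rw [lintegral_const_mul _ hf, lintegral_const_mul _ hg, lintegral_const_mul _ hh] at key
  set F := ∫⁻ x, f x
  set G := ∫⁻ x, g x
  set H := ∫⁻ x, h x
  have h₁ : (M * N)⁻¹ * (F * G) ≤ (M * N)⁻¹ * H ^ 2 := by
    have h₂ := (ENNReal.four_mul_le_add_sq (M⁻¹ * F) (N⁻¹ * G)).trans
      (pow_le_pow_left₀ zero_le key 2)
    have h₃ : (2 * (r⁻¹ * H)) ^ 2 = 4 * ((M * N)⁻¹ * H ^ 2) := by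
      rw [← hr, ENNReal.inv_pow]; ring
    have h₄ : 4 * (M⁻¹ * F * (N⁻¹ * G)) = 4 * ((M * N)⁻¹ * (F * G)) := by
      rw [ENNReal.mul_inv (.inl hM₀) (.inl hf_top)]; ring
    rw [h₃, h₄] at h₂
    exact (ENNReal.mul_le_mul_iff_right (by norm_num) (by norm_num)).1 h₂
  exact (ENNReal.mul_le_mul_iff_right (ENNReal.inv_ne_zero.2 (ENNReal.mul_ne_top hf_top hg_top))
    (ENNReal.inv_ne_top.2 (mul_ne_zero hM₀ hN₀))).1 h₁

/-- The one-dimensional Prékopa-Leindler inequality, at midpoints. -/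
theorem lintegral_mul_lintegral_le_sq {f g h : ℝ → ENNReal} (hf : Measurable f)
    (hg : Measurable g) (hh : Measurable h)
    (hfgh : ∀ x y, f x * g y ≤ h ((x + y) / 2) ^ 2) :
    (∫⁻ x, f x) * ∫⁻ x, g x ≤ (∫⁻ x, h x) ^ 2 := by
  have trunc {u : ℝ → ENNReal} (hu : Measurable u) :
      ∫⁻ x, u x = ⨆ k : ℕ, ∫⁻ x, min (u x) k := by
    rw [← lintegral_iSup (fun k => hu.min measurable_const)
      fun i j hij x => min_le_min_left _ (by exact_mod_cast hij)]
    refine lintegral_congr fun x => ?_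
    rw [← inf_iSup_eq, ENNReal.iSup_natCast, inf_top_eq]
  have ne_top (u : ℝ → ENNReal) (k : ℕ) : ⨆ x, min (u x) k ≠ ⊤ :=
    ((iSup_le fun x => min_le_right _ _).trans_lt (ENNReal.natCast_lt_top k)).ne
  rw [trunc hf, trunc hg, ENNReal.iSup_mul]
  refine iSup_le fun k => ?_
  rw [ENNReal.mul_iSup]
  refine iSup_le fun l => ?_
  refine lintegral_mul_lintegral_le_sq_of_bounded (hf.min measurable_const)
    (hg.min measurable_const) hh (ne_top f k) (ne_top g l) fun x y => ?_
  exact (mul_le_mul' (min_le_left _ _) (min_le_left _ _)).trans (hfgh x y)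
  
/-- The Prékopa-Leindler inequality at midpoints. -/
theorem lintegral_pi_mul_lintegral_pi_le_sq {n : ℕ} {f g h : (Fin n → ℝ) → ENNReal}
    (hf : Measurable f) (hg : Measurable g) (hh : Measurable h)
    (hfgh : ∀ x y, f x * g y ≤ h ((2⁻¹ : ℝ) • (x + y)) ^ 2) :
    (∫⁻ x, f x) * ∫⁻ x, g x ≤ (∫⁻ x, h x) ^ 2 := by
  induction n with
  | zero =>
    have key {u : (Fin 0 → ℝ) → ENNReal} : ∫⁻ x, u x = u 0 := by
      rw [volume_pi, Measure.pi_of_empty _ 0, lintegral_dirac]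
    simpa [key] using hfgh 0 0
  | succ n ih =>
    let e := (MeasurableEquiv.piFinSuccAbove (fun _ : Fin (n + 1) => ℝ) 0).symm
    have he : MeasurePreserving e := (volume_preserving_piFinSuccAbove _ 0).symm
    have fubini {u : (Fin (n + 1) → ℝ) → ENNReal} (hu : Measurable u) :
        ∫⁻ x, u x = ∫⁻ a, ∫⁻ v, u (e (a, v)) := by
      rw [← he.lintegral_comp hu, Measure.volume_eq_prod,
        lintegral_prod (fun z => u (e z)) (hu.comp e.measurable).aemeasurable]
    have meas {u : (Fin (n + 1) → ℝ) → ENNReal} (hu : Measurable u) :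
        Measurable fun a => ∫⁻ v, u (e (a, v)) :=
      (hu.comp e.measurable).lintegral_prod_right'
    rw [fubini hf, fubini hg, fubini hh]
    refine lintegral_mul_lintegral_le_sq (meas hf) (meas hg) (meas hh) fun a b => ?_
    refine ih (by fun_prop) (by fun_prop) (by fun_prop) fun v w => ?_
    convert hfgh (e (a, v)) (e (b, w)) using 3
    ext i
    refine Fin.cases ?_ (fun j => ?_) i <;>
      simp [e, MeasurableEquiv.piFinSuccAbove_symm_apply] <;> ring

/-- The multiplicative Brunn-Minkowski inequality, for midpoints. -/
theorem volume_mul_volume_le_sq {n : ℕ} {A B C : Set (EuclideanSpace ℝ (Fin n))}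
    (hA : MeasurableSet A) (hB : MeasurableSet B) (hC : MeasurableSet C)
    (h : ∀ x ∈ A, ∀ y ∈ B, (2⁻¹ : ℝ) • (x + y) ∈ C) :
    volume A * volume B ≤ volume C ^ 2 := by
  have hmp := PiLp.volume_preserving_toLp (Fin n)
  have key {s : Set (EuclideanSpace ℝ (Fin n))} (hs : MeasurableSet s) :
      volume s = ∫⁻ x : Fin n → ℝ, s.indicator 1 (WithLp.toLp 2 x) := by
    rw [hmp.lintegral_comp (measurable_one.indicator hs), lintegral_indicator_one hs]
  have meas {s : Set (EuclideanSpace ℝ (Fin n))} (hs : MeasurableSet s) :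
      Measurable fun x : Fin n → ℝ =>
        s.indicator (1 : EuclideanSpace ℝ (Fin n) → ENNReal) (WithLp.toLp 2 x) :=
    (measurable_one.indicator hs).comp hmp.measurable
  rw [key hA, key hB, key hC]
  refine lintegral_pi_mul_lintegral_pi_le_sq (meas hA) (meas hB) (meas hC) fun x y => ?_
  by_cases hx : WithLp.toLp 2 x ∈ A
  · by_cases hy : WithLp.toLp 2 y ∈ B
    · have := h _ hx _ hy
      rw [← WithLp.toLp_add, ← WithLp.toLp_smul] at this
      simp only [Set.indicator_of_mem, hx, hy, this]
      simp
    · simp [hy]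
  · simp [hx]

theorem charFun_eq_of_norm_eq {E : Type*} [NormedAddCommGroup E] [InnerProductSpace ℝ E]
    [MeasurableSpace E] [BorelSpace E] {μ : Measure E}
    (hμ : ∀ f : E ≃ₗᵢ[ℝ] E, μ.map f = μ) {v w : E} (h : ‖v‖ = ‖w‖) :
    charFun μ v = charFun μ w := by
  let f := (ℝ ∙ (v - w))ᗮ.reflection
  have hf : f v = w := Submodule.reflection_sub h
  have hf_emb : MeasurableEmbedding f := f.toHomeomorph.measurableEmbedding
  conv_rhs => rw [← hμ f]
  rw [charFun_apply, charFun_apply, hf_emb.integral_map]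
  refine integral_congr_ae (.of_forall fun x => ?_)
  change _ = Complex.exp (inner ℝ (f x) w * Complex.I)
  rw [← hf, f.inner_map_map]

/-- Rotation-invariant probability measures on the unit sphere are unique. -/
theorem eq_of_map_linearIsometryEquiv_eq {E : Type*} [NormedAddCommGroup E]
    [InnerProductSpace ℝ E] [FiniteDimensional ℝ E] [MeasurableSpace E] [BorelSpace E]
    {μ ν : Measure E} [IsProbabilityMeasure μ] [IsProbabilityMeasure ν]
    (hμ₁ : ∀ᵐ x ∂μ, ‖x‖ = 1) (hν₁ : ∀ᵐ x ∂ν, ‖x‖ = 1)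
    (hμ : ∀ f : E ≃ₗᵢ[ℝ] E, μ.map f = μ) (hν : ∀ f : E ≃ₗᵢ[ℝ] E, ν.map f = ν) :
    μ = ν := by
  have average {ρ σ : Measure E} [IsProbabilityMeasure σ] (hσ₁ : ∀ᵐ x ∂σ, ‖x‖ = 1)
      (hρ : ∀ f : E ≃ₗᵢ[ℝ] E, ρ.map f = ρ) (ξ : E) :
      charFun ρ ξ = ∫ y, ∫ x, Complex.exp (inner ℝ x (‖ξ‖ • y) * Complex.I) ∂ρ ∂σ := by
    calc charFun ρ ξ = ∫ _, charFun ρ ξ ∂σ := by simp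
      _ = _ := by
        refine integral_congr_ae ?_
        filter_upwards [hσ₁] with y hy
        exact charFun_eq_of_norm_eq hρ (by simp [norm_smul, hy])
  refine Measure.ext_of_charFun (funext fun ξ => ?_)
  rw [average hν₁ hμ, average hμ₁ hν, integral_integral_swap]
  · simp_rw [inner_smul_right, real_inner_comm]
  · refine Integrable.of_bound (C := 1) (by fun_prop) (.of_forall fun p => ?_)
    simp [Function.uncurry, Complex.norm_exp]

/-- Points in the unit ball with well separated radial projections have a midpoint close to the
origin. -/
theorem norm_midpoint_le_of_lt_dist_radial {E : Type*} [NormedAddCommGroup E]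
    [InnerProductSpace ℝ E] {t : ℝ} (ht : 0 ≤ t) {x y : E} (hx : ‖x‖ ≤ 1) (hy : ‖y‖ ≤ 1)
    (hx₀ : x ≠ 0) (hy₀ : y ≠ 0) (h : t < dist (‖x‖⁻¹ • x) (‖y‖⁻¹ • y)) :
    ‖(2⁻¹ : ℝ) • (x + y)‖ ≤ Real.exp (-(t ^ 2 / 8)) := by
  obtain ⟨a, r, ha, hr, hr₁, rfl⟩ : ∃ (a : E) (r : ℝ), ‖a‖ = 1 ∧ 0 < r ∧ r ≤ 1 ∧ r • a = x :=
    ⟨‖x‖⁻¹ • x, ‖x‖, by simp [norm_smul, hx₀], by simpa, hx, by simp [smul_smul, hx₀]⟩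
  obtain ⟨b, s, hb, hs, hs₁, rfl⟩ : ∃ (b : E) (s : ℝ), ‖b‖ = 1 ∧ 0 < s ∧ s ≤ 1 ∧ s • b = y :=
    ⟨‖y‖⁻¹ • y, ‖y‖, by simp [norm_smul, hy₀], by simpa, hy, by simp [smul_smul, hy₀]⟩
  have normalize {c : E} {q : ℝ} (hc : ‖c‖ = 1) (hq : 0 < q) : ‖q • c‖⁻¹ • q • c = c := by
    rw [norm_smul, hc, Real.norm_of_nonneg hq.le, smul_smul, mul_one, inv_mul_cancel₀ hq.ne',
      one_smul]
  rw [normalize ha hr, normalize hb hs, dist_eq_norm] at h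
  have h₁ : t ^ 2 ≤ 2 - 2 * inner ℝ a b := by
    have := pow_le_pow_left₀ ht h.le 2
    rw [norm_sub_sq_real, ha, hb] at this
    linarith
  have h₂ : -1 ≤ inner ℝ a b := by
    have := abs_le.1 (abs_real_inner_le_norm a b)
    rw [ha, hb] at this
    linarith
  have hexp₁ : 1 - t ^ 2 / 4 ≤ Real.exp (-(t ^ 2 / 4)) := by
    linarith [Real.add_one_le_exp (-(t ^ 2 / 4))]
  have hexp₂ : 1 / 4 ≤ Real.exp (-(t ^ 2 / 4)) := by
    refine le_trans ?_ (Real.exp_le_exp.2 (show -1 ≤ -(t ^ 2 / 4) by linarith))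
    rw [Real.exp_neg, one_div]
    exact inv_anti₀ (Real.exp_pos 1) (by linarith [Real.exp_one_lt_d9])
  have hnorm : ‖(2⁻¹ : ℝ) • (r • a + s • b)‖ ^ 2 =
      (r ^ 2 + 2 * r * s * inner ℝ a b + s ^ 2) / 4 := by
    rw [norm_smul, mul_pow, norm_add_sq_real, norm_smul, norm_smul, ha, hb, real_inner_smul_left,
      real_inner_smul_right]
    simp
    ring
  refine le_of_pow_le_pow_left₀ two_ne_zero (Real.exp_pos _).le ?_
  rw [hnorm, ← Real.exp_nat_mul]
  have : ((2 : ℕ) : ℝ) * -(t ^ 2 / 8) = -(t ^ 2 / 4) := by push_cast; ring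
  rw [this]
  have hmax : (r ^ 2 + 2 * r * s * inner ℝ a b + s ^ 2) / 4 ≤ max (1 - t ^ 2 / 4) (1 / 4) := by
    have hrs : r ^ 2 + 2 * r * s * inner ℝ a b + s ^ 2 ≤
        max (2 + 2 * inner ℝ a b) 1 := by
      set c : ℝ := inner ℝ a b
      rcases le_total (-1) (2 * c) with hc | hc
      · refine le_max_of_le_left ?_
        nlinarith [mul_nonneg hr.le hs.le, mul_nonneg hr.le (sub_nonneg.2 hs₁),
          mul_nonneg hs.le (sub_nonneg.2 hr₁), mul_nonneg (sub_nonneg.2 hr₁) (sub_nonneg.2 hs₁)]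
      · refine le_max_of_le_right ?_
        nlinarith [mul_nonneg hr.le hs.le, mul_nonneg hr.le (sub_nonneg.2 hs₁),
          mul_nonneg hs.le (sub_nonneg.2 hr₁), mul_nonneg (sub_nonneg.2 hr₁) (sub_nonneg.2 hs₁)]
    rcases le_max_iff.1 hrs with h | h
    · exact le_max_of_le_left (by linarith)
    · exact le_max_of_le_right (by linarith)
  exact hmax.trans (max_le hexp₁ hexp₂)

/-- The cone measure formula for the rotation-invariant probability measure on the sphere. -/
theorem measure_eq_cond_closedBall_preimage_radial {E : Type*} [NormedAddCommGroup E]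
    [InnerProductSpace ℝ E] [FiniteDimensional ℝ E] [MeasurableSpace E] [BorelSpace E]
    [Nontrivial E] {ν : Measure E} [IsProbabilityMeasure ν] (hν₁ : ∀ᵐ x ∂ν, ‖x‖ = 1)
    (hν : ∀ f : E ≃ₗᵢ[ℝ] E, ν.map f = ν) :
    ν = (ProbabilityTheory.cond volume (Metric.closedBall (0 : E) 1)).map
      fun x => ‖x‖⁻¹ • x := by
  have hrad : Measurable fun x : E => ‖x‖⁻¹ • x := by fun_prop
  have hball₀ : volume (Metric.closedBall (0 : E) 1) ≠ 0 :=
    (Metric.measure_closedBall_pos _ _ one_pos).ne'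
  have := ProbabilityTheory.cond_isProbabilityMeasure_of_finite hball₀
    measure_closedBall_lt_top.ne
  have := Measure.isProbabilityMeasure_map
    (μ := ProbabilityTheory.cond volume (Metric.closedBall (0 : E) 1)) hrad.aemeasurable
  refine eq_of_map_linearIsometryEquiv_eq hν₁ ?_ hν fun f => ?_
  · rw [ae_map_iff hrad.aemeasurable (measurableSet_eq_fun measurable_norm measurable_const)]
    have h₀ : ∀ᵐ x ∂(volume : Measure E), x ≠ 0 := compl_mem_ae_iff.2 (measure_singleton 0)
    filter_upwards [ProbabilityTheory.cond_absolutelyContinuous.ae_le h₀] with x hx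
    simp [norm_smul, hx]
  · have hf : Measurable f := f.continuous.measurable
    rw [Measure.map_map hf hrad]
    have hcomm : f ∘ (fun x => ‖x‖⁻¹ • x) = (fun x => ‖x‖⁻¹ • x) ∘ f := by ext x; simp
    rw [hcomm, ← Measure.map_map hrad hf]
    congr 1
    rw [ProbabilityTheory.cond, Measure.map_smul]
    congr 1
    have hpre : f ⁻¹' Metric.closedBall 0 1 = Metric.closedBall 0 1 := by ext x; simp
    conv_lhs => rw [← hpre]
    exact (f.measurePreserving.restrict_preimage measurableSet_closedBall).map_eq

/-- **Concentration of measure on the sphere.** For the rotation-invariant (Haar)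
probability measure `ν` on `S^{n-1} ⊆ ℝ^n`, a measurable `A ⊆ S^{n-1}` and `t > 0`,
with `A_t = {x ∈ S^{n-1} : d(x,A) ≤ t}` we have `ν(A)·ν(S^{n-1} \ A_t) ≤ 4 exp(-t² n/4)`. -/
theorem sphere_concentration (n : ℕ) (hn : 1 ≤ n)
    (ν : Measure (EuclideanSpace ℝ (Fin n))) [IsProbabilityMeasure ν]
    (hsupp : ν (Metric.sphere (0 : EuclideanSpace ℝ (Fin n)) 1) = 1)
    (hinv : ∀ f : EuclideanSpace ℝ (Fin n) ≃ₗᵢ[ℝ] EuclideanSpace ℝ (Fin n),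
      Measure.map f ν = ν)
    (A : Set (EuclideanSpace ℝ (Fin n))) (hA : MeasurableSet A)
    (hAsub : A ⊆ Metric.sphere (0 : EuclideanSpace ℝ (Fin n)) 1)
    (t : ℝ) (ht : 0 < t) :
    (ν A).toReal *
      (ν (Metric.sphere (0 : EuclideanSpace ℝ (Fin n)) 1 \
          {x | x ∈ Metric.sphere (0 : EuclideanSpace ℝ (Fin n)) 1 ∧
            Metric.infDist x A ≤ t})).toReal
      ≤ 4 * Real.exp (-(t ^ 2 * n) / 4) := by
  have : Nonempty (Fin n) := ⟨⟨0, hn⟩⟩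
  set B := Metric.sphere (0 : EuclideanSpace ℝ (Fin n)) 1 \
    {x | x ∈ Metric.sphere (0 : EuclideanSpace ℝ (Fin n)) 1 ∧ Metric.infDist x A ≤ t}
  have hB : MeasurableSet B :=
    Metric.isClosed_sphere.measurableSet.diff (Metric.isClosed_sphere.measurableSet.inter
      (measurableSet_le (Metric.continuous_infDist_pt A).measurable measurable_const))
  have hν₁ : ∀ᵐ x ∂ν, ‖x‖ = 1 := by
    filter_upwards [(prob_compl_eq_zero_iff Metric.isClosed_sphere.measurableSet).2 hsupp]
      with x hx
    simpa using hx
  set ball := Metric.closedBall (0 : EuclideanSpace ℝ (Fin n)) 1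
  have hball₀ : volume ball ≠ 0 := (Metric.measure_closedBall_pos _ _ one_pos).ne'
  have hball_top : volume ball ≠ ⊤ := measure_closedBall_lt_top.ne
  let rad : EuclideanSpace ℝ (Fin n) → EuclideanSpace ℝ (Fin n) := fun x => ‖x‖⁻¹ • x
  have hrad : Measurable rad := by fun_prop
  have hν {s : Set (EuclideanSpace ℝ (Fin n))} (hs : MeasurableSet s) :
      ν s = (volume ball)⁻¹ * volume (ball ∩ rad ⁻¹' s) := by
    conv_lhs => rw [measure_eq_cond_closedBall_preimage_radial hν₁ hinv]
    rw [Measure.map_apply hrad hs, ProbabilityTheory.cond_apply measurableSet_closedBall]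
  set ρ := Real.exp (-(t ^ 2 / 8)) with hρ
  have ne_zero {x : EuclideanSpace ℝ (Fin n)} (hx : rad x ∈ Metric.sphere 0 1) : x ≠ 0 := by
    rintro rfl
    simp [rad] at hx
  have hvol : volume (ball ∩ rad ⁻¹' A) * volume (ball ∩ rad ⁻¹' B) ≤
      volume (Metric.closedBall (0 : EuclideanSpace ℝ (Fin n)) ρ) ^ 2 := by
    refine volume_mul_volume_le_sq (measurableSet_closedBall.inter (hrad hA))
      (measurableSet_closedBall.inter (hrad hB)) measurableSet_closedBall ?_
    rintro x ⟨hx, hxA⟩ y ⟨hy, hyB⟩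
    rw [mem_closedBall_zero_iff] at hx hy ⊢
    refine norm_midpoint_le_of_lt_dist_radial ht.le hx hy (ne_zero (hAsub hxA))
      (ne_zero hyB.1) ?_
    have h₁ : t < Metric.infDist (rad y) A := by
      by_contra! hcon
      exact hyB.2 ⟨hyB.1, hcon⟩
    rw [dist_comm]
    exact h₁.trans_le (Metric.infDist_le_dist_of_mem hxA)
  rw [Measure.addHaar_closedBall' _ _ (Real.exp_pos _).le, finrank_euclideanSpace_fin] at hvol
  have hmain : ν A * ν B ≤ ENNReal.ofReal (ρ ^ n) ^ 2 := by
    calc ν A * ν B = (volume ball)⁻¹ ^ 2 *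
          (volume (ball ∩ rad ⁻¹' A) * volume (ball ∩ rad ⁻¹' B)) := by
          rw [hν hA, hν hB]; ring
      _ ≤ (volume ball)⁻¹ ^ 2 * (ENNReal.ofReal (ρ ^ n) * volume ball) ^ 2 := by gcongr
      _ = ((volume ball)⁻¹ * volume ball) ^ 2 * ENNReal.ofReal (ρ ^ n) ^ 2 := by ring
      _ = ENNReal.ofReal (ρ ^ n) ^ 2 := by
          rw [ENNReal.inv_mul_cancel hball₀ hball_top, one_pow, one_mul]
  rw [← ENNReal.toReal_mul]
  have hexp : (ρ ^ n) ^ 2 = Real.exp (-(t ^ 2 * n) / 4) := by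
    rw [hρ, ← pow_mul, ← Real.exp_nat_mul]
    congr 1
    push_cast
    ring
  calc (ν A * ν B).toReal ≤ (ρ ^ n) ^ 2 := by
        refine ENNReal.toReal_le_of_le_ofReal (by positivity) ?_
        rwa [ENNReal.ofReal_pow (by positivity)]
    _ ≤ 4 * Real.exp (-(t ^ 2 * n) / 4) := by
        rw [hexp]
        linarith [Real.exp_pos (-(t ^ 2 * n) / 4)]
end

section
/- Let n ≥ 1 be an integer, let A ⊆ {0,1}^n be any subset, and let c > 0 be a real number. Define A_c := {x ∈ {0,1}^n : there exists y ∈ A with Δ(x,y) ≤ c√n}. Then, with probabilities taken over a uniformly random element of {0,1}^n, Pr(x ∈ A) · Pr(x ∉ A_c) ≤ e^{−c²}; equivalently, (|A|/2^n) · (1 − |A_c|/2^n) ≤ e^{−c²}. -/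
/-- Two-point step: if `a₀ b₀, a₁ b₁ ≤ K` and the ratios `a₀ / a₁`, `b₀ / b₁` lie in
`[exp (-t), exp t]`, then `(a₀ + a₁) (b₀ + b₁) ≤ 4 K exp (t ^ 2 / 4)`. -/
theorem add_mul_add_le_exp {a₀ a₁ b₀ b₁ K t : ℝ} (ha₀ : 0 < a₀) (ha₁ : 0 < a₁)
    (hb₀ : 0 < b₀) (hb₁ : 0 < b₁) (h₀ : a₀ * b₀ ≤ K) (h₁ : a₁ * b₁ ≤ K)
    (ha₀₁ : a₀ ≤ Real.exp t * a₁) (ha₁₀ : a₁ ≤ Real.exp t * a₀)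
    (hb₀₁ : b₀ ≤ Real.exp t * b₁) (hb₁₀ : b₁ ≤ Real.exp t * b₀) :
    (a₀ + a₁) * (b₀ + b₁) ≤ 4 * K * Real.exp (t ^ 2 / 4) := by
  have hK : 0 < K := (mul_pos ha₀ hb₀).trans_le h₀
  have he : Real.exp t * Real.exp (-t) = 1 := by rw [← Real.exp_add]; simp
  have hcosh : 2 * Real.cosh t = Real.exp t + Real.exp (-t) := by rw [Real.cosh_eq]; ring
  have hu : a₀ * b₁ ≤ Real.exp t ^ 2 * (a₁ * b₀) := by
    calc a₀ * b₁ ≤ (Real.exp t * a₁) * (Real.exp t * b₀) := by gcongr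
      _ = _ := by ring
  have hv : a₁ * b₀ ≤ Real.exp t ^ 2 * (a₀ * b₁) := by
    calc a₁ * b₀ ≤ (Real.exp t * a₀) * (Real.exp t * b₁) := by gcongr
      _ = _ := by ring
  have huv : (a₀ * b₁) * (a₁ * b₀) ≤ K ^ 2 := by
    calc (a₀ * b₁) * (a₁ * b₀) = (a₀ * b₀) * (a₁ * b₁) := by ring
      _ ≤ K * K := by gcongr
      _ = _ := by ring
  have hcross : a₀ * b₁ + a₁ * b₀ ≤ K * (2 * Real.cosh t) := by
    refine le_of_sq_le_sq ?_ (by positivity)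
    generalize a₀ * b₁ = u at *
    generalize a₁ * b₀ = v at *
    have hprod : 0 ≤ Real.exp (-t) ^ 2 *
        ((Real.exp t ^ 2 * v - u) * (Real.exp t ^ 2 * u - v)) :=
      mul_nonneg (sq_nonneg _) (mul_nonneg (sub_nonneg.2 hu) (sub_nonneg.2 hv))
    have hexpand : Real.exp (-t) ^ 2 * ((Real.exp t ^ 2 * v - u) * (Real.exp t ^ 2 * u - v)) =
        u * v * (2 * Real.cosh t) ^ 2 - (u + v) ^ 2 := by
      rw [hcosh]
      linear_combination (u * v * Real.exp t ^ 2 * (Real.exp t * Real.exp (-t) + 1)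
        - (u ^ 2 + v ^ 2) * (Real.exp t * Real.exp (-t) + 1) - 2 * u * v) * he
    calc (u + v) ^ 2 ≤ u * v * (2 * Real.cosh t) ^ 2 := by linarith
      _ ≤ K ^ 2 * (2 * Real.cosh t) ^ 2 := by gcongr
      _ = _ := by ring
  have hhalf : 2 + 2 * Real.cosh t = 4 * Real.cosh (t / 2) ^ 2 := by
    have h := Real.cosh_two_mul (t / 2)
    rw [Real.sinh_sq, mul_div_cancel₀ t two_ne_zero] at h
    linarith
  have hexp : Real.cosh (t / 2) ^ 2 ≤ Real.exp (t ^ 2 / 4) := by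
    calc Real.cosh (t / 2) ^ 2 ≤ Real.exp ((t / 2) ^ 2 / 2) ^ 2 := by
          gcongr; exact Real.cosh_le_exp_half_sq _
      _ = Real.exp (t ^ 2 / 4) := by rw [← Real.exp_nat_mul]; congr 1; push_cast; ring
  calc (a₀ + a₁) * (b₀ + b₁) ≤ K * (2 + 2 * Real.cosh t) := by linarith
    _ = 4 * K * Real.cosh (t / 2) ^ 2 := by rw [hhalf]; ring
    _ ≤ _ := by gcongr

/-- Exponential moment bound on the cube for a function whose value changes by at most `t`
when one coordinate is modified. -/
theorem sum_exp_mul_sum_exp_neg_le {t : ℝ} (n : ℕ) (f : (Fin n → Bool) → ℝ)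
    (hf : ∀ x i b, f x ≤ t + f (Function.update x i b)) :
    (∑ x, Real.exp (f x)) * (∑ x, Real.exp (-f x)) ≤ 4 ^ n * Real.exp (n * (t ^ 2 / 4)) := by
  induction n with
  | zero => simp [← Real.exp_add]
  | succ n ih =>
    have hsplit (g : (Fin (n + 1) → Bool) → ℝ) :
        ∑ x, g x = ∑ x : Fin n → Bool, g (Fin.cons false x) +
          ∑ x : Fin n → Bool, g (Fin.cons true x) := by
      rw [← (Fin.consEquiv fun _ ↦ Bool).sum_comp, Fintype.sum_prod_type, Fintype.sum_bool,
        add_comm]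
      rfl
    have hrec (b : Bool) := ih (fun x ↦ f (Fin.cons b x)) fun x i c ↦ by
      simpa only [Fin.cons_update] using hf (Fin.cons b x) i.succ c
    have hflip (b c : Bool) (x : Fin n → Bool) : f (Fin.cons b x) ≤ t + f (Fin.cons c x) := by
      simpa using hf (Fin.cons b x) 0 c
    have hpos (b : Bool) : 0 < ∑ x : Fin n → Bool, Real.exp (f (Fin.cons b x)) :=
      Finset.sum_pos (fun _ _ ↦ Real.exp_pos _) Finset.univ_nonempty
    have hneg (b : Bool) : 0 < ∑ x : Fin n → Bool, Real.exp (-f (Fin.cons b x)) :=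
      Finset.sum_pos (fun _ _ ↦ Real.exp_pos _) Finset.univ_nonempty
    have hposle (b c : Bool) : ∑ x : Fin n → Bool, Real.exp (f (Fin.cons b x)) ≤
        Real.exp t * ∑ x : Fin n → Bool, Real.exp (f (Fin.cons c x)) := by
      rw [Finset.mul_sum]
      gcongr with x
      rw [← Real.exp_add]
      exact Real.exp_le_exp.2 (hflip b c x)
    have hnegle (b c : Bool) : ∑ x : Fin n → Bool, Real.exp (-f (Fin.cons b x)) ≤
        Real.exp t * ∑ x : Fin n → Bool, Real.exp (-f (Fin.cons c x)) := by
      rw [Finset.mul_sum]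
      gcongr with x
      rw [← Real.exp_add]
      exact Real.exp_le_exp.2 (by linarith [hflip c b x])
    rw [hsplit, hsplit fun x ↦ Real.exp (-f x)]
    refine (add_mul_add_le_exp (hpos _) (hpos _) (hneg _) (hneg _) (hrec false) (hrec true)
      (hposle _ _) (hposle _ _) (hnegle _ _) (hnegle _ _)).trans_eq ?_
    rw [Nat.cast_succ, add_one_mul, Real.exp_add]
    ring

theorem hammingDist_update_le_one {ι : Type*} {β : ι → Type*} [Fintype ι] [DecidableEq ι]
    [∀ i, DecidableEq (β i)] (x : ∀ i, β i) (i : ι) (b : β i) :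
    hammingDist x (Function.update x i b) ≤ 1 := by
  refine (Finset.card_le_card (t := {i}) fun j hj ↦ ?_).trans_eq (Finset.card_singleton i)
  by_contra h
  simp_all

/-- If `A` and `B` are at Hamming distance at least `r`, then `|A| |B| exp (s r)` is bounded by
the exponential moments of `s` times the distance to `A`. -/
theorem ncard_mul_ncard_mul_exp_le {n : ℕ} {A B : Set (Fin n → Bool)} {r s : ℝ} (hs : 0 ≤ s)
    (hAB : ∀ x ∈ B, ∀ y ∈ A, r ≤ hammingDist x y) :
    (A.ncard : ℝ) * B.ncard * Real.exp (s * r) ≤ 4 ^ n * Real.exp (n * (s ^ 2 / 4)) := by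
  classical
  rcases A.eq_empty_or_nonempty with rfl | hA
  · simp only [Set.ncard_empty, Nat.cast_zero, zero_mul]; positivity
  let S : Set (Hamming fun _ : Fin n ↦ Bool) := Hamming.ofHamming ⁻¹' A
  have hS : S.Nonempty := hA
  let f (x : Fin n → Bool) : ℝ := s * Metric.infDist (Hamming.toHamming x) S
  have hf (x i b) : f x ≤ s + f (Function.update x i b) := by
    have h₁ := Metric.infDist_le_infDist_add_dist (s := S) (x := Hamming.toHamming x)
      (y := Hamming.toHamming (Function.update x i b))
    have h₂ : dist (Hamming.toHamming x) (Hamming.toHamming (Function.update x i b)) ≤ 1 := by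
      rw [Hamming.dist_eq_hammingDist]
      exact_mod_cast hammingDist_update_le_one x i b
    calc f x ≤ s * (Metric.infDist (Hamming.toHamming (Function.update x i b)) S + 1) :=
          mul_le_mul_of_nonneg_left (by linarith) hs
      _ = _ := by ring
  have hAsum : (A.ncard : ℝ) ≤ ∑ x, Real.exp (-f x) := by
    rw [Set.ncard_eq_toFinset_card', ← nsmul_one, ← Finset.sum_const]
    refine (Finset.sum_le_sum fun x hx ↦ ?_).trans
      (Finset.sum_le_univ_sum_of_nonneg fun x ↦ (Real.exp_pos (-f x)).le)
    have hx' : Hamming.toHamming x ∈ S := Set.mem_toFinset.1 hx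
    simp [f, Metric.infDist_zero_of_mem hx']
  have hBsum : B.ncard * Real.exp (s * r) ≤ ∑ x, Real.exp (f x) := by
    rw [Set.ncard_eq_toFinset_card', ← nsmul_eq_mul, ← Finset.sum_const]
    refine (Finset.sum_le_sum fun x hx ↦ ?_).trans
      (Finset.sum_le_univ_sum_of_nonneg fun x ↦ (Real.exp_pos (f x)).le)
    refine Real.exp_le_exp.2 (mul_le_mul_of_nonneg_left ((Metric.le_infDist hS).2 ?_) hs)
    intro y hy
    rw [Hamming.dist_eq_hammingDist]
    exact hAB x (by simpa using hx) _ hy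
  calc (A.ncard : ℝ) * B.ncard * Real.exp (s * r)
      = (B.ncard * Real.exp (s * r)) * A.ncard := by ring
    _ ≤ (∑ x, Real.exp (f x)) * ∑ x, Real.exp (-f x) := by gcongr
    _ ≤ _ := sum_exp_mul_sum_exp_neg_le n f hf


/-- **Concentration of measure on the Hamming cube.** For any `A ⊆ {0,1}^n` and `c > 0`,
with `A_c = {x : ∃ y ∈ A, Δ(x,y) ≤ c√n}`, we have
`(|A|/2^n) · (1 - |A_c|/2^n) ≤ exp(-c²)`. -/
theorem hamming_cube_concentration (n : ℕ) (hn : 1 ≤ n) (A : Set (Fin n → Bool))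
    (c : ℝ) (hc : 0 < c) :
    ((A.ncard : ℝ) / 2 ^ n) *
      (1 - (({x : Fin n → Bool |
          ∃ y ∈ A, (hammingDist x y : ℝ) ≤ c * Real.sqrt n}).ncard : ℝ) / 2 ^ n)
      ≤ Real.exp (-c ^ 2) := by
  set E : Set (Fin n → Bool) := {x | ∃ y ∈ A, (hammingDist x y : ℝ) ≤ c * Real.sqrt n} with hE
  have hn' : (0 : ℝ) < n := by exact_mod_cast hn
  have hsqrt : 0 < Real.sqrt n := Real.sqrt_pos.2 hn'
  have hsq : Real.sqrt n ^ 2 = n := Real.sq_sqrt hn'.le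
  have hcard : (E.ncard : ℝ) + Eᶜ.ncard = 2 ^ n := by
    have h := Set.ncard_add_ncard_compl E
    rw [Nat.card_eq_fintype_card, Fintype.card_fun, Fintype.card_bool, Fintype.card_fin] at h
    exact_mod_cast h
  have hcompl : 1 - (E.ncard : ℝ) / 2 ^ n = Eᶜ.ncard / 2 ^ n := by
    rw [← hcard]
    have : (E.ncard : ℝ) + Eᶜ.ncard ≠ 0 := by rw [hcard]; positivity
    field_simp
    ring
  have key := ncard_mul_ncard_mul_exp_le (A := A) (B := Eᶜ) (r := c * Real.sqrt n)
    (s := 2 * c / Real.sqrt n) (by positivity) fun x hx y hy ↦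
      le_of_not_ge fun h ↦ hx ⟨y, hy, h⟩
  have hs₁ : 2 * c / Real.sqrt n * (c * Real.sqrt n) = c ^ 2 + c ^ 2 := by field_simp; ring
  have hs₂ : n * ((2 * c / Real.sqrt n) ^ 2 / 4) = c ^ 2 := by
    rw [div_pow, hsq]; field_simp; ring
  rw [hs₁, hs₂, Real.exp_add, ← mul_assoc] at key
  rw [hcompl, div_mul_div_comm, ← mul_pow, Real.exp_neg, ← one_div,
    div_le_div_iff₀ (by positivity) (Real.exp_pos _), one_mul]
  norm_num only
  exact le_of_mul_le_mul_right key (Real.exp_pos _)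
end

section
/- For every integer n ≥ 1, the volumes of Euclidean unit balls satisfy ω_{n−1}/ω_n < √((n+1)/(2π)), and consequently ω_{n−1}/ω_n < √n. -/
open MeasureTheory

/-- `ω_d`: the `d`-dimensional Lebesgue volume of the Euclidean unit ball in `ℝ^d`. -/
noncomputable def unitBallVol (d : ℕ) : ℝ :=
  (volume (Metric.ball (0 : EuclideanSpace ℝ (Fin d)) 1)).toReal

theorem Real.Gamma_add_half_sq_le {s : ℝ} (hs : 0 < s) :
    Real.Gamma (s + 1 / 2) ^ 2 ≤ s * Real.Gamma s ^ 2 := by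
  have hs1 : 0 < s + 1 := by linarith
  have h := Real.Gamma_mul_add_mul_le_rpow_Gamma_mul_rpow_Gamma hs hs1
    (a := 1 / 2) (b := 1 / 2) (by norm_num) (by norm_num) (by norm_num)
  have hsum : 1 / 2 * s + 1 / 2 * (s + 1) = s + 1 / 2 := by ring
  rw [hsum, ← Real.sqrt_eq_rpow, ← Real.sqrt_eq_rpow] at h
  calc Real.Gamma (s + 1 / 2) ^ 2
      ≤ (√(Real.Gamma s) * √(Real.Gamma (s + 1))) ^ 2 :=
        pow_le_pow_left₀ (Real.Gamma_pos_of_pos (by linarith)).le h 2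
    _ = s * Real.Gamma s ^ 2 := by
        rw [mul_pow, Real.sq_sqrt (Real.Gamma_pos_of_pos hs).le,
          Real.sq_sqrt (Real.Gamma_pos_of_pos hs1).le, Real.Gamma_add_one hs.ne']
        ring

theorem Real.Gamma_add_half_sq_lt {s : ℝ} (hs : 0 < s) :
    Real.Gamma (s + 1 / 2) ^ 2 < s * Real.Gamma s ^ 2 := by
  have h := Real.Gamma_add_half_sq_le (s := s + 1) (by linarith)
  have hs2 : 0 < s + 1 / 2 := by linarith
  have hsum : s + 1 + 1 / 2 = (s + 1 / 2) + 1 := by ring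
  rw [hsum, Real.Gamma_add_one hs2.ne', Real.Gamma_add_one hs.ne', mul_pow, mul_pow] at h
  have hG : 0 < s * Real.Gamma s ^ 2 := mul_pos hs (pow_pos (Real.Gamma_pos_of_pos hs) 2)
  refine lt_of_mul_lt_mul_left (h.trans_lt ?_) (sq_nonneg (s + 1 / 2))
  nlinarith

theorem unitBallVol_eq (d : ℕ) :
    unitBallVol d = √Real.pi ^ d / Real.Gamma (d / 2 + 1) := by
  rcases Nat.eq_zero_or_pos d with rfl | hd
  · have hball : Metric.ball (0 : EuclideanSpace ℝ (Fin 0)) 1 = Set.univ :=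
      Set.eq_univ_of_forall fun x => by simp [Subsingleton.elim x 0]
    rw [unitBallVol, hball, volume_euclideanSpace_eq_dirac]
    simp
  · have : Nonempty (Fin d) := ⟨⟨0, hd⟩⟩
    have hG : 0 < Real.Gamma (d / 2 + 1 : ℝ) := Real.Gamma_pos_of_pos (by positivity)
    rw [unitBallVol, EuclideanSpace.volume_ball]
    simp [ENNReal.toReal_ofReal (div_nonneg (pow_nonneg (Real.sqrt_nonneg Real.pi) d) hG.le)]

theorem unitBallVol_div_succ (m : ℕ) :
    unitBallVol m / unitBallVol (m + 1) =
      Real.Gamma ((m / 2 + 1 : ℝ) + 1 / 2) / (√Real.pi * Real.Gamma (m / 2 + 1)) := by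
  have hG : 0 < Real.Gamma (m / 2 + 1 : ℝ) := Real.Gamma_pos_of_pos (by positivity)
  have hG' : 0 < Real.Gamma ((m / 2 + 1 : ℝ) + 1 / 2) := Real.Gamma_pos_of_pos (by positivity)
  have hπ : 0 < √Real.pi := Real.sqrt_pos.2 Real.pi_pos
  have hsum : ((m + 1 : ℕ) : ℝ) / 2 + 1 = (m / 2 + 1 : ℝ) + 1 / 2 := by push_cast; ring
  rw [unitBallVol_eq, unitBallVol_eq, hsum, pow_succ]
  field_simp

/-- For every `n ≥ 1`, `ω_{n-1}/ω_n < √((n+1)/(2π))`, and consequently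
`ω_{n-1}/ω_n < √n`. -/
theorem unitBallVol_ratio_lt (n : ℕ) (hn : 1 ≤ n) :
    unitBallVol (n - 1) / unitBallVol n < Real.sqrt ((n + 1) / (2 * Real.pi)) ∧
    unitBallVol (n - 1) / unitBallVol n < Real.sqrt n := by
  obtain ⟨m, rfl⟩ := Nat.exists_eq_add_of_le' hn
  have hlt : unitBallVol m / unitBallVol (m + 1) <
      Real.sqrt (((m + 1 : ℕ) + 1) / (2 * Real.pi)) := by
    have hs : (0 : ℝ) < m / 2 + 1 := by positivity
    have hG := Real.Gamma_pos_of_pos hs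
    rw [unitBallVol_div_succ]
    apply Real.lt_sqrt_of_sq_lt
    rw [div_pow, mul_pow, Real.sq_sqrt Real.pi_pos.le,
      div_lt_div_iff₀ (by positivity) (by positivity)]
    have h := mul_lt_mul_of_pos_right (Real.Gamma_add_half_sq_lt hs) Real.two_pi_pos
    refine h.trans_eq ?_
    push_cast
    ring
  refine ⟨hlt, hlt.trans_le (Real.sqrt_le_sqrt ?_)⟩
  rw [div_le_iff₀ Real.two_pi_pos]
  push_cast
  nlinarith [Real.pi_gt_three, (Nat.cast_nonneg m : (0 : ℝ) ≤ m)]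
end
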